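/- Self-similarity of the generalized Wiener process at the density level: let d ≥ 1 be an integer, η > 0, q real with (d+2)(q-1) < 2η, λ real, and α = η + dλ(1-q) > 0. Then for all c > 0, t > 0, and x ∈ ℝ^d, c^{d/(2α)} · G_θ(c^{1/(2α)} x; 0, (ct)^{1/α} I_d) = G_θ(x; 0, t^{1/α} I_d); that is, the law of c^{-1/(2α)} Q_{ct}^ϑ coincides with the law of Q_t^ϑ. -/

import Mathlib

open MeasureTheory Real

/-- The real `q`-exponential. -/
noncomputable def qExp (q u : ℝ) : ℝ :=
  if q = 1 then Real.exp u
  else if 0 < 1 + (1 - q) * u then (1 + (1 - q) * u) ^ (1 / (1 - q)) else 0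

/-- `π_θ = (∫_{ℝ^d} exp_q(-‖x‖^{2η}) dx)^{2/d}`. -/
noncomputable def piTheta (q η : ℝ) (d : ℕ) : ℝ :=
  (∫ x : EuclideanSpace ℝ (Fin d), qExp q (-‖x‖ ^ (2 * η))) ^ (2 / (d : ℝ))

/-- `2_θ = d π_θ^{d/2} / ∫_{ℝ^d} ‖x‖² exp_q(-‖x‖^{2η}) dx`. -/
noncomputable def twoTheta (q η : ℝ) (d : ℕ) : ℝ :=
  d * piTheta q η d ^ ((d : ℝ) / 2) /
    ∫ x : EuclideanSpace ℝ (Fin d), ‖x‖ ^ 2 * qExp q (-‖x‖ ^ (2 * η))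

/-- The θ-Gaussian density with scalar covariance `σ²I_d`:
`G_θ(x;0,σ²I_d) = exp_q(-(‖x‖²/σ²)^η/2_θ) / (2_θπ_θσ²)^{d/2}`. -/
noncomputable def GthetaS (q η : ℝ) (d : ℕ) (σ2 : ℝ) (x : EuclideanSpace ℝ (Fin d)) : ℝ :=
  qExp q (-((‖x‖ ^ 2 / σ2) ^ η / twoTheta q η d)) /
    (twoTheta q η d * piTheta q η d * σ2) ^ ((d : ℝ) / 2)

theorem qExp_nonneg (q u : ℝ) : 0 ≤ qExp q u := by
  unfold qExp
  split_ifs <;> positivity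

theorem piTheta_nonneg (q η : ℝ) (d : ℕ) : 0 ≤ piTheta q η d :=
  rpow_nonneg (integral_nonneg fun _ => qExp_nonneg _ _) _

theorem twoTheta_nonneg (q η : ℝ) (d : ℕ) : 0 ≤ twoTheta q η d :=
  div_nonneg (mul_nonneg d.cast_nonneg (rpow_nonneg (piTheta_nonneg q η d) _))
    (integral_nonneg fun _ => mul_nonneg (sq_nonneg _) (qExp_nonneg _ _))

/-- The θ-Gaussian densities form a scale family. -/
theorem rpow_mul_GthetaS_smul (q η : ℝ) (d : ℕ) {a σ2 : ℝ} (ha : 0 < a) (hσ : 0 ≤ σ2)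
    (x : EuclideanSpace ℝ (Fin d)) :
    a ^ (d : ℝ) * GthetaS q η d (a ^ 2 * σ2) (a • x) = GthetaS q η d σ2 x := by
  have hA : 0 ≤ twoTheta q η d * piTheta q η d * σ2 :=
    mul_nonneg (mul_nonneg (twoTheta_nonneg q η d) (piTheta_nonneg q η d)) hσ
  have hpow : (a ^ 2) ^ ((d : ℝ) / 2) = a ^ (d : ℝ) := by
    rw [← rpow_natCast_mul ha.le]
    congr 1
    push_cast
    ring
  unfold GthetaS
  rw [norm_smul, norm_of_nonneg ha.le, mul_pow, mul_div_mul_left _ _ (pow_pos ha 2).ne',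
    mul_left_comm _ (a ^ 2), mul_rpow (sq_nonneg a) hA, hpow, ← mul_div_assoc,
    mul_div_mul_left _ _ (rpow_pos_of_pos ha _).ne']

/-- self-similarity of the generalized Wiener process at the density
level: for `c, t > 0`, `c^{d/(2α)} G_θ(c^{1/(2α)}x; 0, (ct)^{1/α}I_d) = G_θ(x;0,t^{1/α}I_d)`,
i.e. `c^{-1/(2α)}Q_{ct}^ϑ` has the same law as `Q_t^ϑ`. -/
theorem stmt13 (d : ℕ) (hd : 1 ≤ d) (η q lam : ℝ) (hη : 0 < η)
    (hcond : ((d : ℝ) + 2) * (q - 1) < 2 * η)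
    (α : ℝ) (hα : α = η + d * lam * (1 - q)) (hαpos : 0 < α)
    (c t : ℝ) (hc : 0 < c) (ht : 0 < t) (x : EuclideanSpace ℝ (Fin d)) :
    c ^ ((d : ℝ) / (2 * α)) *
        GthetaS q η d ((c * t) ^ (1 / α)) ((c ^ (1 / (2 * α))) • x) =
      GthetaS q η d (t ^ (1 / α)) x := by
  have hsq : (c * t) ^ (1 / α) = (c ^ (1 / (2 * α))) ^ 2 * t ^ (1 / α) := by
    rw [mul_rpow hc.le ht.le, ← rpow_mul_natCast hc.le]
    congr 2
    push_cast
    field_simp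
  have hexp : c ^ ((d : ℝ) / (2 * α)) = (c ^ (1 / (2 * α))) ^ (d : ℝ) := by
    rw [← rpow_mul hc.le, one_div_mul_eq_div]
  rw [hsq, hexp]
  exact rpow_mul_GthetaS_smul q η d (rpow_pos_of_pos hc _) (rpow_nonneg ht.le _) x
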